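/- For every n ≥ 8: ZC2(PC(1^{n−6}, 2, 1, 1, 1)) < ZC2(PC(2, 1^{n−4}, 2)) and ZC2(PC(2^{n−6}, 1, 2, 2, 2)) > ZC2(PC(1, 2^{n−4}, 1)). -/

import Mathlib

noncomputable section
open scoped Classical
open Finset

/-- Taxicab (L¹) distance between two lattice points. -/
def taxicab (u v : ℤ × ℤ) : ℕ := (u.1 - v.1).natAbs + (u.2 - v.2).natAbs

/-- `c 0, …, c (n-1)` are the lower-left corners of the `n` unit squares of a
polyomino chain: the cells are pairwise distinct and two cells share a common
edge (i.e. their lower-left corners are at taxicab distance 1) iff they are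
consecutive in the chain, so that the centers of the squares form a path. -/
def IsPolyominoChain (n : ℕ) (c : ℕ → ℤ × ℤ) : Prop :=
  (∀ i j, i < n → j < n → c i = c j → i = j) ∧
  (∀ i j, i < n → j < n → (taxicab (c i) (c j) = 1 ↔ (i = j + 1 ∨ j = i + 1)))

/-- `v` is a corner of the unit square with lower-left corner `s`. -/
def IsSquareCorner (s v : ℤ × ℤ) : Prop :=
  v = s ∨ v = s + (1, 0) ∨ v = s + (0, 1) ∨ v = s + (1, 1)

/-- The vertex set of the graph of a polyomino chain: all corners of its squares. -/
def corners (n : ℕ) (c : ℕ → ℤ × ℤ) : Finset (ℤ × ℤ) :=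
  (Finset.range n).biUnion fun i => {c i, c i + (1, 0), c i + (0, 1), c i + (1, 1)}

/-- The graph of a polyomino chain: vertices are corners of the squares, and
two corners are adjacent iff they are the endpoints of a unit side of one of
the squares of the chain. -/
def chainGraph (n : ℕ) (c : ℕ → ℤ × ℤ) : SimpleGraph (ℤ × ℤ) :=
  SimpleGraph.fromRel fun u v =>
    taxicab u v = 1 ∧ ∃ i < n, IsSquareCorner (c i) u ∧ IsSquareCorner (c i) v

/-- `tau n c v` = number of vertices of the chain graph at graph distance exactly 2 from `v`. -/
def tau (n : ℕ) (c : ℕ → ℤ × ℤ) (v : ℤ × ℤ) : ℕ :=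
  ((corners n c).filter fun u => (chainGraph n c).dist v u = 2).card

/-- First Zagreb connection index `ZC1 = ∑_{v ∈ V} τ_v²`. -/
def ZC1 (n : ℕ) (c : ℕ → ℤ × ℤ) : ℕ := ∑ v ∈ corners n c, tau n c v ^ 2

/-- Second Zagreb connection index `ZC2 = ∑_{uv ∈ E} τ_u · τ_v`
(each edge appears twice in the double sum, whence the division by 2). -/
def ZC2 (n : ℕ) (c : ℕ → ℤ × ℤ) : ℕ :=
  (∑ u ∈ corners n c, ∑ v ∈ corners n c,
      if (chainGraph n c).Adj u v then tau n c u * tau n c v else 0) / 2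

/-- The link `L_k` (for `3 ≤ k ≤ n`) of a polyomino chain: `1` if the `k`-th
square continues the current straight segment, `2` if it is attached at a kink. -/
def link (c : ℕ → ℤ × ℤ) (k : ℕ) : ℕ :=
  if c (k - 1) - c (k - 2) = c (k - 2) - c (k - 3) then 1 else 2

/-- Indicator of a proposition, as an integer. -/
def ind (P : Prop) : ℤ := if P then 1 else 0

/-- The chain `c` with `n` squares has `m` segments, of lengths `l 1, …, l m`:
there are cut positions `2 = k 0 < k 1 < ⋯ < k (m-1) < k m = n+1` such that the
kink links (links equal to 2) are exactly at positions `k 1, …, k (m-1)`, and the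
`j`-th segment has length `l j = k j - k (j-1) + 1`. -/
def HasSegments (n : ℕ) (c : ℕ → ℤ × ℤ) (m : ℕ) (l : ℕ → ℕ) : Prop :=
  ∃ k : ℕ → ℕ, k 0 = 2 ∧ k m = n + 1 ∧
    (∀ j, 1 ≤ j → j ≤ m → k (j - 1) < k j) ∧
    (∀ x, 3 ≤ x → x ≤ n → (link c x = 2 ↔ ∃ j, 1 ≤ j ∧ j ≤ m - 1 ∧ k j = x)) ∧
    (∀ j, 1 ≤ j → j ≤ m → l j = k j - k (j - 1) + 1)

/-- The chain `c` with `n` squares has link sequence `L_3, …, L_n`. -/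
def HasLinks (n : ℕ) (c : ℕ → ℤ × ℤ) (L : ℕ → ℕ) : Prop :=
  ∀ k, 3 ≤ k → k ≤ n → link c k = L k

/-- The linear chain `Li_n` (all links equal to 1). -/
def linCell : ℕ → ℤ × ℤ := fun i => ((i : ℤ), 0)

/-- The zigzag chain `Z_n` (all links equal to 2). -/
def zigCell : ℕ → ℤ × ℤ := fun i => ((((i + 1) / 2 : ℕ) : ℤ), ((i / 2 : ℕ) : ℤ))

/-- The unit side from `(x, y)` to `(x + 1, y)` belongs to a cell of `S`. -/
def eastEdge (S : ℤ → ℤ → Bool) (x y : ℤ) : Bool := S x y || S x (y - 1)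

/-- The unit side from `(x, y)` to `(x, y + 1)` belongs to a cell of `S`. -/
def northEdge (S : ℤ → ℤ → Bool) (x y : ℤ) : Bool := S x y || S (x - 1) y

/-- The number of vertices at distance two from `(x, y)` in the graph of the cell set `S`. -/
def cellTau (S : ℤ → ℤ → Bool) (x y : ℤ) : ℕ :=
  (eastEdge S x y && eastEdge S (x + 1) y).toNat +
  (eastEdge S (x - 1) y && eastEdge S (x - 2) y).toNat +
  (northEdge S x y && northEdge S x (y + 1)).toNat +
  (northEdge S x (y - 1) && northEdge S x (y - 2)).toNat +
  (eastEdge S x y && northEdge S (x + 1) y ||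
    northEdge S x y && eastEdge S x (y + 1)).toNat +
  (eastEdge S (x - 1) y && northEdge S (x - 1) y ||
    northEdge S x y && eastEdge S (x - 1) (y + 1)).toNat +
  (eastEdge S x y && northEdge S (x + 1) (y - 1) ||
    northEdge S x (y - 1) && eastEdge S x (y - 1)).toNat +
  (eastEdge S (x - 1) y && northEdge S (x - 1) (y - 1) ||
    northEdge S x (y - 1) && eastEdge S (x - 1) (y - 1)).toNat

/-- The contribution of the vertex `(x, y)` to the sum of `τ_u τ_v` over ordered adjacent pairs. -/
def cellWeight (S : ℤ → ℤ → Bool) (x y : ℤ) : ℕ :=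
  (if eastEdge S x y then cellTau S x y * cellTau S (x + 1) y else 0) +
  (if eastEdge S (x - 1) y then cellTau S x y * cellTau S (x - 1) y else 0) +
  (if northEdge S x y then cellTau S x y * cellTau S x (y + 1) else 0) +
  (if northEdge S x (y - 1) then cellTau S x y * cellTau S x (y - 1) else 0)

/-- The sum of `τ_u τ_v` over ordered adjacent pairs in the graph of the cell set `S`. -/
def cellSum (S : ℤ → ℤ → Bool) : ℕ := ∑ᶠ v : ℤ × ℤ, cellWeight S v.1 v.2

theorem cellSum_translate (S : ℤ → ℤ → Bool) (p q : ℤ) :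
    cellSum (fun x y => S (x + p) (y + q)) = cellSum S := by
  have hE : ∀ x y, eastEdge (fun x y => S (x + p) (y + q)) x y = eastEdge S (x + p) (y + q) := by
    intro x y; simp only [eastEdge, add_sub_right_comm]
  have hN : ∀ x y, northEdge (fun x y => S (x + p) (y + q)) x y = northEdge S (x + p) (y + q) := by
    intro x y; simp only [northEdge, add_sub_right_comm]
  have hT : ∀ x y, cellTau (fun x y => S (x + p) (y + q)) x y = cellTau S (x + p) (y + q) := by
    intro x y
    simp only [cellTau, hE, hN, add_sub_right_comm, add_right_comm _ p, add_right_comm _ q]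
  have hW : ∀ x y,
      cellWeight (fun x y => S (x + p) (y + q)) x y = cellWeight S (x + p) (y + q) := by
    intro x y
    simp only [cellWeight, hE, hN, hT, add_sub_right_comm, add_right_comm _ p, add_right_comm _ q]
  simp only [cellSum, hW]
  exact finsum_comp_equiv (f := fun v : ℤ × ℤ => cellWeight S v.1 v.2)
    ((Equiv.addRight p).prodCongr (Equiv.addRight q))

theorem cellSum_swap (S : ℤ → ℤ → Bool) : cellSum (fun x y => S y x) = cellSum S := by
  have hE : ∀ x y, eastEdge (fun x y => S y x) x y = northEdge S y x := fun _ _ => rfl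
  have hN : ∀ x y, northEdge (fun x y => S y x) x y = eastEdge S y x := fun _ _ => rfl
  have hT : ∀ x y, cellTau (fun x y => S y x) x y = cellTau S y x := by
    intro x y
    simp only [cellTau, hE, hN, Bool.or_comm (northEdge S _ _ && _)]
    ring
  have hW : ∀ x y, cellWeight (fun x y => S y x) x y = cellWeight S y x := by
    intro x y
    simp only [cellWeight, hE, hN, hT]
    ring
  simp only [cellSum, hW]
  exact finsum_comp_equiv (f := fun v : ℤ × ℤ => cellWeight S v.1 v.2) (Equiv.prodComm ℤ ℤ)

theorem cellSum_neg (S : ℤ → ℤ → Bool) : cellSum (fun x y => S (-x) y) = cellSum S := by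
  have hE : ∀ x y, eastEdge (fun x y => S (-x) y) x y = eastEdge S (-x) y := fun _ _ => rfl
  have hN : ∀ x y, northEdge (fun x y => S (-x) y) x y = northEdge S (1 - x) y := by
    intro x y
    simp only [northEdge, Bool.or_comm (S (-x) y)]
    congr 2 <;> ring
  have e1 : ∀ x : ℤ, 1 - (x + 1) = -x := fun x => by ring
  have e2 : ∀ x : ℤ, 1 - (x - 1) = 1 - x + 1 := fun x => by ring
  have e3 : ∀ x : ℤ, -(x - 1) = 1 - x := fun x => by ring
  have e4 : ∀ x : ℤ, -(x + 1) = 1 - x - 2 := fun x => by ring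
  have e5 : ∀ x : ℤ, -(x - 2) = 1 - x + 1 := fun x => by ring
  have e6 : ∀ x : ℤ, 1 - x - 1 = -x := fun x => by ring
  have hT : ∀ x y, cellTau (fun x y => S (-x) y) x y = cellTau S (1 - x) y := by
    intro x y
    simp only [cellTau, hE, hN, e1, e2, e3, e4, e5, e6]
    ring
  have hW : ∀ x y, cellWeight (fun x y => S (-x) y) x y = cellWeight S (1 - x) y := by
    intro x y
    simp only [cellWeight, hE, hN, hT, e1, e2, e3, e6]
    ring
  simp only [cellSum, hW]
  exact finsum_comp_equiv (f := fun v : ℤ × ℤ => cellWeight S v.1 v.2)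
    ((Equiv.subLeft 1).prodCongr (Equiv.refl ℤ))

theorem cellSum_frame (S : ℤ → ℤ → Bool) (p q a b a' b' : ℤ)
    (hd : a.natAbs + b.natAbs = 1) (he : a' = -b ∧ b' = a ∨ a' = b ∧ b' = -a) :
    cellSum (fun x y => S (p + x * a + y * a') (q + x * b + y * b')) = cellSum S := by
  set T : ℤ → ℤ → Bool := fun x y => S (x + p) (y + q) with hT
  have hS : cellSum T = cellSum S := cellSum_translate S p q
  have h1 : ∀ U, cellSum (fun x y => U x (-y)) = cellSum U := fun U => by
    rw [← cellSum_swap, cellSum_neg (fun x y => U y x), cellSum_swap]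
  have key : (fun x y => S (p + x * a + y * a') (q + x * b + y * b')) =
      fun x y => T (x * a + y * a') (x * b + y * b') := by
    funext x y
    simp only [hT]
    congr 1 <;> ring
  rw [key, ← hS]
  have hab : (a = 1 ∧ b = 0) ∨ (a = -1 ∧ b = 0) ∨ (a = 0 ∧ b = 1) ∨ (a = 0 ∧ b = -1) := by omega
  have n1 := cellSum_neg T
  have n2 := h1 T
  have n3 := (cellSum_neg fun x y => T x (-y)).trans n2
  have s1 := cellSum_swap T
  have s2 := (cellSum_swap fun x y => T (-x) y).trans n1
  have s3 := (cellSum_swap fun x y => T x (-y)).trans n2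
  have s4 := (cellSum_swap fun x y => T (-x) (-y)).trans n3
  rcases hab with ⟨rfl, rfl⟩ | ⟨rfl, rfl⟩ | ⟨rfl, rfl⟩ | ⟨rfl, rfl⟩ <;>
    rcases he with ⟨rfl, rfl⟩ | ⟨rfl, rfl⟩ <;> simp <;> assumption

theorem eastEdge_congr {S T : ℤ → ℤ → Bool} {x y : ℤ} (h : S x y = T x y)
    (h' : S x (y - 1) = T x (y - 1)) : eastEdge S x y = eastEdge T x y := by
  simp only [eastEdge, h, h']

theorem northEdge_congr {S T : ℤ → ℤ → Bool} {x y : ℤ} (h : S x y = T x y)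
    (h' : S (x - 1) y = T (x - 1) y) : northEdge S x y = northEdge T x y := by
  simp only [northEdge, h, h']

theorem cellTau_congr {S T : ℤ → ℤ → Bool} {x y : ℤ}
    (h : ∀ a b : ℤ, (2 * (a - x) + 1).natAbs + (2 * (b - y) + 1).natAbs ≤ 4 → S a b = T a b) :
    cellTau S x y = cellTau T x y := by
  have hE : ∀ a b : ℤ, (2 * (a - x) + 1).natAbs + 2 * (b - y).natAbs ≤ 3 →
      eastEdge S a b = eastEdge T a b := fun a b hab => by
    apply eastEdge_congr <;> apply h <;> omega
  have hN : ∀ a b : ℤ, 2 * (a - x).natAbs + (2 * (b - y) + 1).natAbs ≤ 3 →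
      northEdge S a b = northEdge T a b := fun a b hab => by
    apply northEdge_congr <;> apply h <;> omega
  simp (disch := omega) only [cellTau, hE, hN]

theorem cellWeight_congr {S T : ℤ → ℤ → Bool} {x y : ℤ}
    (h : ∀ a b : ℤ, (2 * (a - x) + 1).natAbs + (2 * (b - y) + 1).natAbs ≤ 6 → S a b = T a b) :
    cellWeight S x y = cellWeight T x y := by
  have hE : eastEdge S x y = eastEdge T x y := by apply eastEdge_congr <;> apply h <;> omega
  have hE' : eastEdge S (x - 1) y = eastEdge T (x - 1) y := by
    apply eastEdge_congr <;> apply h <;> omega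
  have hN : northEdge S x y = northEdge T x y := by apply northEdge_congr <;> apply h <;> omega
  have hN' : northEdge S x (y - 1) = northEdge T x (y - 1) := by
    apply northEdge_congr <;> apply h <;> omega
  have ht : ∀ a b : ℤ, (a - x).natAbs + (b - y).natAbs ≤ 1 → cellTau S a b = cellTau T a b :=
    fun a b hab => cellTau_congr fun a' b' h' => h a' b' (by omega)
  simp only [cellWeight, hE, hE', hN, hN', ht x y (by omega), ht (x + 1) y (by omega),
    ht (x - 1) y (by omega), ht x (y + 1) (by omega), ht x (y - 1) (by omega)]

theorem exists_cell_of_cellWeight_ne_zero {S : ℤ → ℤ → Bool} {x y : ℤ}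
    (h : cellWeight S x y ≠ 0) :
    S x y = true ∨ S (x - 1) y = true ∨ S x (y - 1) = true ∨ S (x - 1) (y - 1) = true := by
  contrapose! h
  simp [cellWeight, eastEdge, northEdge, h]

/-- The cell set `S` lies in the square `[-M, M]²`. -/
def CellBounded (S : ℤ → ℤ → Bool) (M : ℕ) : Prop :=
  ∀ x y, S x y = true → x.natAbs ≤ M ∧ y.natAbs ≤ M

theorem CellBounded.support_subset {S : ℤ → ℤ → Bool} {M : ℕ} (h : CellBounded S M) :
    Function.support (fun v : ℤ × ℤ => cellWeight S v.1 v.2) ⊆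
      (Finset.Icc (-M : ℤ) (M + 1) ×ˢ Finset.Icc (-M : ℤ) (M + 1) : Finset (ℤ × ℤ)) := by
  rintro ⟨x, y⟩ hv
  simp only [Finset.coe_product, Finset.coe_Icc, Set.mem_prod, Set.mem_Icc]
  rcases exists_cell_of_cellWeight_ne_zero hv with h' | h' | h' | h' <;>
    have := h _ _ h' <;> omega

theorem CellBounded.finite_support {S : ℤ → ℤ → Bool} {M : ℕ} (h : CellBounded S M) :
    (Function.support fun v : ℤ × ℤ => cellWeight S v.1 v.2).Finite :=
  (Finset.finite_toSet _).subset h.support_subset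

/-- Adding a cell changes `cellSum` by an amount that only depends on the cells near it. -/
theorem cellSum_local {S T S' T' : ℤ → ℤ → Bool} {M N M' N' : ℕ} (x₀ y₀ : ℤ)
    (bS : CellBounded S M) (bT : CellBounded T N) (bS' : CellBounded S' M')
    (bT' : CellBounded T' N')
    (hST : ∀ x y, ¬(x = x₀ ∧ y = y₀) → T x y = S x y)
    (hST' : ∀ x y, ¬(x = x₀ ∧ y = y₀) → T' x y = S' x y)
    (hnear : ∀ x y, (x - x₀).natAbs + (y - y₀).natAbs ≤ 6 → S x y = S' x y ∧ T x y = T' x y) :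
    cellSum T + cellSum S' = cellSum T' + cellSum S := by
  unfold cellSum
  rw [← finsum_add_distrib bT.finite_support bS'.finite_support,
    ← finsum_add_distrib bT'.finite_support bS.finite_support]
  congr 1
  funext ⟨x, y⟩
  by_cases hv : (2 * (x₀ - x) + 1).natAbs + (2 * (y₀ - y) + 1).natAbs ≤ 6
  · have h1 : cellWeight T x y = cellWeight T' x y :=
      cellWeight_congr fun a b hab => (hnear a b (by omega)).2
    have h2 : cellWeight S x y = cellWeight S' x y :=
      cellWeight_congr fun a b hab => (hnear a b (by omega)).1
    simp only [h1, h2]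
  · have h1 : cellWeight T x y = cellWeight S x y :=
      cellWeight_congr fun a b hab => hST a b (by rintro ⟨rfl, rfl⟩; exact hv hab)
    have h2 : cellWeight T' x y = cellWeight S' x y :=
      cellWeight_congr fun a b hab => hST' a b (by rintro ⟨rfl, rfl⟩; exact hv hab)
    simp only [h1, h2, add_comm]

theorem CellBounded.cellSum_eq {S : ℤ → ℤ → Bool} {M : ℕ} (h : CellBounded S M) :
    cellSum S = ∑ x ∈ Finset.Icc (-M : ℤ) (M + 1), ∑ y ∈ Finset.Icc (-M : ℤ) (M + 1),
      cellWeight S x y := by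
  rw [cellSum, finsum_eq_sum_of_support_subset _ h.support_subset, Finset.sum_product]

theorem CellBounded.frame {S : ℤ → ℤ → Bool} {M : ℕ} (h : CellBounded S M) (p q a b a' b' : ℤ)
    (hd : a.natAbs + b.natAbs = 1) (he : a' = -b ∧ b' = a ∨ a' = b ∧ b' = -a) :
    CellBounded (fun x y => S (p + x * a + y * a') (q + x * b + y * b'))
      (M + p.natAbs + q.natAbs) := by
  intro x y hxy
  have := h _ _ hxy
  have hab : (a = 1 ∧ b = 0) ∨ (a = -1 ∧ b = 0) ∨ (a = 0 ∧ b = 1) ∨ (a = 0 ∧ b = -1) := by omega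
  rcases hab with ⟨rfl, rfl⟩ | ⟨rfl, rfl⟩ | ⟨rfl, rfl⟩ | ⟨rfl, rfl⟩ <;>
    rcases he with ⟨rfl, rfl⟩ | ⟨rfl, rfl⟩ <;> omega

/-- If a lattice isometry matches the neighbourhoods of two added cells, then both additions
change `cellSum` by the same amount. -/
theorem cellSum_local_frame {S T S' T' : ℤ → ℤ → Bool} {M N M' N' : ℕ} (x₀ y₀ : ℤ)
    (p q a b a' b' : ℤ)
    (hd : a.natAbs + b.natAbs = 1) (he : a' = -b ∧ b' = a ∨ a' = b ∧ b' = -a)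
    (bS : CellBounded S M) (bT : CellBounded T N) (bS' : CellBounded S' M')
    (bT' : CellBounded T' N')
    (hST : ∀ x y, ¬(x = x₀ ∧ y = y₀) → T x y = S x y ∧
      T' (p + x * a + y * a') (q + x * b + y * b') = S' (p + x * a + y * a') (q + x * b + y * b'))
    (hnear : ∀ x y, (x - x₀).natAbs + (y - y₀).natAbs ≤ 6 →
      S x y = S' (p + x * a + y * a') (q + x * b + y * b') ∧
      T x y = T' (p + x * a + y * a') (q + x * b + y * b')) :
    cellSum T + cellSum S' = cellSum T' + cellSum S := by
  rw [← cellSum_frame S' p q a b a' b' hd he, ← cellSum_frame T' p q a b a' b' hd he]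
  exact cellSum_local x₀ y₀ bS bT (bS'.frame p q a b a' b' hd he) (bT'.frame p q a b a' b' hd he)
    (fun x y h => (hST x y h).1) (fun x y h => (hST x y h).2) hnear

/-- The cells of the chain with links `1, 1, 1, 2, 1, …, 1`. -/
def hookCells (n : ℕ) (x y : ℤ) : Bool :=
  decide ((y = 0 ∧ 0 ≤ x ∧ x ≤ 4) ∨ (x = 4 ∧ 0 ≤ y ∧ y + 5 ≤ n))

/-- The cells of the chain with links `2, 1, …, 1`. -/
def cappedLine (n : ℕ) (x y : ℤ) : Bool :=
  decide ((x = 0 ∧ y = 0) ∨ (x = 1 ∧ 0 ≤ y ∧ y + 2 ≤ n))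

/-- The cells of the chain with links `2, 1, …, 1, 2`; the sign `s` is the side of the last kink. -/
def doublyCappedLine (s : ℤ) (n : ℕ) (x y : ℤ) : Bool :=
  decide ((x = 0 ∧ y = 0) ∨ (x = 1 ∧ 0 ≤ y ∧ y + 3 ≤ n) ∨ (x = 1 + s ∧ y + 3 = n))

/-- The cells of the chain with links `2, 2, 2, 1, 2, …, 2`; the sign `s` is the side of the
kink after the straight link. -/
def bentZigzag (s : ℤ) (n : ℕ) (x y : ℤ) : Bool :=
  decide ((x + y ≤ 4 ∧ (y = x ∨ y = x - 1) ∧ 0 ≤ y) ∨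
    (5 ≤ 2 + s * (x - 2) + y ∧ 2 + s * (x - 2) + y + 1 ≤ n ∧
      (y = 2 + s * (x - 2) ∨ y = 3 + s * (x - 2))))

/-- The cells of the chain with links `1, 2, …, 2`. -/
def cappedZigzag (n : ℕ) (x y : ℤ) : Bool :=
  decide ((x = 0 ∧ y = 0) ∨ ((x = y + 1 ∨ x = y + 2) ∧ 0 ≤ y ∧ x + y + 1 ≤ n))

/-- The cells of the chain with links `1, 2, …, 2, 1`. -/
def doublyCappedZigzag (n : ℕ) (x y : ℤ) : Bool :=
  decide ((x = 0 ∧ y = 0) ∨ ((x = y + 1 ∨ x = y + 2) ∧ 0 ≤ y ∧ x + y + 2 ≤ n) ∨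
    (x + y + 1 = n ∧ (x = y ∨ x = y + 3)))

theorem hookCells_bounded {n : ℕ} (hn : 8 ≤ n) : CellBounded (hookCells n) n := by
  intro x y h
  simp only [hookCells, decide_eq_true_eq] at h
  omega

theorem cappedLine_bounded {n : ℕ} (hn : 7 ≤ n) : CellBounded (cappedLine n) n := by
  intro x y h
  simp only [cappedLine, decide_eq_true_eq] at h
  omega

theorem doublyCappedLine_bounded {n : ℕ} (hn : 8 ≤ n) {s : ℤ} (hs : s = 1 ∨ s = -1) :
    CellBounded (doublyCappedLine s n) n := by
  intro x y h
  simp only [doublyCappedLine, decide_eq_true_eq] at h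
  omega

theorem bentZigzag_bounded {n : ℕ} (hn : 8 ≤ n) {s : ℤ} (hs : s = 1 ∨ s = -1) :
    CellBounded (bentZigzag s n) n := by
  intro x y h
  simp only [bentZigzag, decide_eq_true_eq] at h
  rcases hs with rfl | rfl <;> omega

theorem cappedZigzag_bounded {n : ℕ} (hn : 7 ≤ n) : CellBounded (cappedZigzag n) n := by
  intro x y h
  simp only [cappedZigzag, decide_eq_true_eq] at h
  omega

theorem doublyCappedZigzag_bounded {n : ℕ} (hn : 8 ≤ n) :
    CellBounded (doublyCappedZigzag n) n := by
  intro x y h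
  simp only [doublyCappedZigzag, decide_eq_true_eq] at h
  omega

theorem cellSum_hookCells_step {n : ℕ} (hn : 11 ≤ n) :
    cellSum (hookCells (n + 2)) + cellSum (hookCells n) = 2 * cellSum (hookCells (n + 1)) := by
  rw [two_mul]
  refine cellSum_local_frame 4 (n - 3) 0 (-1) 1 0 0 1 (by simp) (by simp)
    (hookCells_bounded (by omega)) (hookCells_bounded (by omega)) (hookCells_bounded (by omega))
    (hookCells_bounded (by omega)) ?_ ?_ <;>
  · intro x y h
    simp only [hookCells, decide_eq_decide]
    omega

theorem cellSum_cappedLine_step {n : ℕ} (hn : 11 ≤ n) :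
    cellSum (cappedLine (n + 2)) + cellSum (cappedLine n) = 2 * cellSum (cappedLine (n + 1)) := by
  rw [two_mul]
  refine cellSum_local_frame 1 n 0 (-1) 1 0 0 1 (by simp) (by simp)
    (cappedLine_bounded (by omega)) (cappedLine_bounded (by omega)) (cappedLine_bounded (by omega))
    (cappedLine_bounded (by omega)) ?_ ?_ <;>
  · intro x y h
    simp only [cappedLine, decide_eq_decide]
    omega

theorem cellSum_doublyCappedLine_step {n : ℕ} (hn : 11 ≤ n) {s : ℤ} (hs : s = 1 ∨ s = -1) :
    cellSum (doublyCappedLine s (n + 2)) + cellSum (cappedLine n) =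
      cellSum (doublyCappedLine s (n + 1)) + cellSum (cappedLine (n + 1)) := by
  refine cellSum_local_frame (1 + s) (n - 1) 0 (-1) 1 0 0 1 (by simp) (by simp)
    (cappedLine_bounded (by omega)) (doublyCappedLine_bounded (by omega) hs)
    (cappedLine_bounded (by omega)) (doublyCappedLine_bounded (by omega) hs) ?_ ?_ <;>
  · intro x y h
    simp only [cappedLine, doublyCappedLine, decide_eq_decide]
    omega

theorem cellSum_bentZigzag_step {n : ℕ} (hn : 11 ≤ n) {s : ℤ} (hs : s = 1 ∨ s = -1) :
    cellSum (bentZigzag s (n + 2)) + cellSum (bentZigzag s n) =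
      2 * cellSum (bentZigzag s (n + 1)) := by
  rw [two_mul]
  have hx : ∃ u v : ℤ, u + v = n + 1 ∧ (v = u ∨ v = u + 1) := by
    refine ⟨(n + 1) / 2, (n + 2) / 2, ?_, ?_⟩ <;> omega
  obtain ⟨u, v, huv, huv'⟩ := hx
  refine cellSum_local_frame (2 + s * (u - 2)) v (2 - 3 * s) (2 - 2 * s) 0 s s 0 ?_ ?_
    (bentZigzag_bounded (by omega) hs) (bentZigzag_bounded (by omega) hs)
    (bentZigzag_bounded (by omega) hs) (bentZigzag_bounded (by omega) hs) ?_ ?_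
  · rcases hs with rfl | rfl <;> rfl
  · simp
  all_goals
    intro x y h
    simp only [bentZigzag, decide_eq_decide]
    rcases hs with rfl | rfl <;> omega

theorem cellSum_cappedZigzag_step {n : ℕ} (hn : 11 ≤ n) :
    cellSum (cappedZigzag (n + 2)) + cellSum (cappedZigzag n) =
      2 * cellSum (cappedZigzag (n + 1)) := by
  rw [two_mul]
  have hx : ∃ u v : ℤ, u + v = n + 1 ∧ (u = v + 1 ∨ u = v + 2) := by
    refine ⟨(n + 3) / 2, n + 1 - (n + 3) / 2, ?_, ?_⟩ <;> omega
  obtain ⟨u, v, huv, huv'⟩ := hx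
  refine cellSum_local_frame u v 1 (-2) 0 1 1 0 (by simp) (by simp)
    (cappedZigzag_bounded (by omega)) (cappedZigzag_bounded (by omega))
    (cappedZigzag_bounded (by omega)) (cappedZigzag_bounded (by omega)) ?_ ?_ <;>
  · intro x y h
    simp only [cappedZigzag, decide_eq_decide]
    omega

theorem cellSum_doublyCappedZigzag_step {n : ℕ} (hn : 11 ≤ n) :
    cellSum (doublyCappedZigzag (n + 2)) + cellSum (cappedZigzag n) =
      cellSum (doublyCappedZigzag (n + 1)) + cellSum (cappedZigzag (n + 1)) := by
  have hx : ∃ u v : ℤ, u + v = n + 1 ∧ (u = v ∨ u = v + 3) := by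
    rcases Nat.even_or_odd' n with ⟨k, hk | hk⟩
    · exact ⟨k + 2, k - 1, by omega, by omega⟩
    · exact ⟨k + 1, k + 1, by omega, by omega⟩
  obtain ⟨u, v, huv, huv'⟩ := hx
  refine cellSum_local_frame u v 1 (-2) 0 1 1 0 (by simp) (by simp)
    (cappedZigzag_bounded (by omega)) (doublyCappedZigzag_bounded (by omega))
    (cappedZigzag_bounded (by omega)) (doublyCappedZigzag_bounded (by omega)) ?_ ?_ <;>
  · intro x y h
    simp only [cappedZigzag, doublyCappedZigzag, decide_eq_decide]
    omega

theorem eq_of_two_step {f : ℕ → ℕ} {k a b : ℕ} (h0 : f k + b = a * k)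
    (h1 : f (k + 1) + b = a * (k + 1)) (hf : ∀ n, k ≤ n → f (n + 2) + f n = 2 * f (n + 1))
    {n : ℕ} (hn : k ≤ n) : f n + b = a * n := by
  suffices h : f n + b = a * n ∧ f (n + 1) + b = a * (n + 1) from h.1
  induction n, hn using Nat.le_induction with
  | base => exact ⟨h0, h1⟩
  | succ n hn ih =>
    refine ⟨ih.2, ?_⟩
    have := hf n hn
    rw [add_assoc, one_add_one_eq_two]
    linarith [ih.1, ih.2]

theorem eq_of_relative_step {f g : ℕ → ℕ} {k a b c : ℕ} (h0 : f (k + 1) + c = a * (k + 1))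
    (hg : ∀ n, k ≤ n → g n + b = a * n)
    (hf : ∀ n, k ≤ n → f (n + 2) + g n = f (n + 1) + g (n + 1))
    {n : ℕ} (hn : k + 1 ≤ n) : f n + c = a * n := by
  induction n, hn using Nat.le_induction with
  | base => exact h0
  | succ n hn ih =>
    obtain ⟨m, rfl⟩ := Nat.exists_eq_add_of_le' (show 1 ≤ n by omega)
    have := hf m (by omega)
    rw [add_assoc m, one_add_one_eq_two]
    have h1 := hg m (by omega)
    have h2 := hg (m + 1) (by omega)
    linarith

theorem cellSum_hookCells_le {n : ℕ} (hn : 8 ≤ n) : cellSum (hookCells n) + 88 ≤ 96 * n := by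
  by_cases h : 11 ≤ n
  · refine (eq_of_two_step (f := fun n => cellSum (hookCells n)) (k := 11) ?_ ?_
      (fun n hn => cellSum_hookCells_step hn) h).le <;>
    · rw [(hookCells_bounded (by norm_num)).cellSum_eq]
      decide +kernel
  · rw [(hookCells_bounded hn).cellSum_eq]
    interval_cases n <;> decide +kernel

theorem cellSum_cappedLine {n : ℕ} (hn : 11 ≤ n) : cellSum (cappedLine n) + 116 = 96 * n := by
  refine eq_of_two_step (f := fun n => cellSum (cappedLine n)) (k := 11) ?_ ?_
    (fun n hn => cellSum_cappedLine_step hn) hn <;>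
  · rw [(cappedLine_bounded (by norm_num)).cellSum_eq]
    decide +kernel

theorem cellSum_doublyCappedLine {n : ℕ} (hn : 8 ≤ n) {s : ℤ} (hs : s = 1 ∨ s = -1) :
    cellSum (doublyCappedLine s n) + 76 = 96 * n := by
  by_cases h : 12 ≤ n
  · refine eq_of_relative_step (f := fun n => cellSum (doublyCappedLine s n)) (k := 11) ?_
      (fun n hn => cellSum_cappedLine hn)
      (fun n hn => cellSum_doublyCappedLine_step hn hs) h
    rw [(doublyCappedLine_bounded (by norm_num) hs).cellSum_eq]
    rcases hs with rfl | rfl <;> decide +kernel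
  · rw [(doublyCappedLine_bounded hn hs).cellSum_eq]
    rcases hs with rfl | rfl <;> interval_cases n <;> decide +kernel

theorem le_cellSum_bentZigzag {n : ℕ} (hn : 8 ≤ n) {s : ℤ} (hs : s = 1 ∨ s = -1) :
    150 * n ≤ cellSum (bentZigzag s n) + 358 := by
  by_cases h : 11 ≤ n
  · have h0 : ∀ n, 8 ≤ n → cellSum (bentZigzag s n) = _ := fun n hn =>
      (bentZigzag_bounded hn hs).cellSum_eq
    rcases hs with rfl | rfl
    · refine (eq_of_two_step (f := fun n => cellSum (bentZigzag 1 n)) (k := 11) (b := 358) ?_ ?_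
        (fun n hn => cellSum_bentZigzag_step hn (by norm_num)) h).ge <;>
      · rw [h0 _ (by norm_num)]
        decide +kernel
    · refine (eq_of_two_step (f := fun n => cellSum (bentZigzag (-1) n)) (k := 11) (a := 150)
        (b := 334) ?_ ?_ (fun n hn => cellSum_bentZigzag_step hn (by norm_num)) h).ge.trans
        (Nat.add_le_add_left (by norm_num) _) <;>
      · rw [h0 _ (by norm_num)]
        decide +kernel
  · rw [(bentZigzag_bounded hn hs).cellSum_eq]
    rcases hs with rfl | rfl <;> interval_cases n <;> decide +kernel

theorem cellSum_cappedZigzag {n : ℕ} (hn : 11 ≤ n) :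
    cellSum (cappedZigzag n) + 348 = 150 * n := by
  refine eq_of_two_step (f := fun n => cellSum (cappedZigzag n)) (k := 11) ?_ ?_
    (fun n hn => cellSum_cappedZigzag_step hn) hn <;>
  · rw [(cappedZigzag_bounded (by norm_num)).cellSum_eq]
    decide +kernel

theorem cellSum_doublyCappedZigzag {n : ℕ} (hn : 8 ≤ n) :
    cellSum (doublyCappedZigzag n) + 378 = 150 * n := by
  by_cases h : 12 ≤ n
  · refine eq_of_relative_step (f := fun n => cellSum (doublyCappedZigzag n)) (k := 11) ?_
      (fun n hn => cellSum_cappedZigzag hn)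
      (fun n hn => cellSum_doublyCappedZigzag_step hn) h
    rw [(doublyCappedZigzag_bounded (by norm_num)).cellSum_eq]
    decide +kernel
  · rw [(doublyCappedZigzag_bounded hn).cellSum_eq]
    interval_cases n <;> decide +kernel

/-- The cells `c 0, …, c (n - 1)` as an indicator function. -/
def chainCells (n : ℕ) (c : ℕ → ℤ × ℤ) (x y : ℤ) : Bool := decide (∃ i < n, c i = (x, y))

theorem chainCells_eq_true {n : ℕ} {c : ℕ → ℤ × ℤ} {x y : ℤ} :
    chainCells n c x y = true ↔ ∃ i < n, c i = (x, y) := by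
  simp [chainCells]

theorem isSquareCorner_iff {s v : ℤ × ℤ} : IsSquareCorner s v ↔
    s = v ∨ s = (v.1 - 1, v.2) ∨ s = (v.1, v.2 - 1) ∨ s = (v.1 - 1, v.2 - 1) := by
  simp only [IsSquareCorner, Prod.ext_iff, Prod.fst_add, Prod.snd_add]
  omega

theorem mem_corners {n : ℕ} {c : ℕ → ℤ × ℤ} {v : ℤ × ℤ} :
    v ∈ corners n c ↔ ∃ i < n, IsSquareCorner (c i) v := by
  simp [corners, IsSquareCorner]

theorem chainGraph_adj {n : ℕ} {c : ℕ → ℤ × ℤ} {u v : ℤ × ℤ} : (chainGraph n c).Adj u v ↔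
    taxicab u v = 1 ∧ ∃ i < n, IsSquareCorner (c i) u ∧ IsSquareCorner (c i) v := by
  have hne : taxicab u v = 1 → u ≠ v := by
    rintro h rfl
    simp [taxicab] at h
  have hsymm : taxicab v u = taxicab u v := by
    simp only [taxicab]; omega
  simp only [chainGraph, SimpleGraph.fromRel_adj, hsymm, and_comm (a := IsSquareCorner _ v), or_self]
  exact ⟨fun h => h.2, fun h => ⟨hne h.1, h⟩⟩

theorem chainGraph_adj_mem {n : ℕ} {c : ℕ → ℤ × ℤ} {u v : ℤ × ℤ} (h : (chainGraph n c).Adj u v) :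
    v ∈ corners n c := by
  obtain ⟨-, i, hi, -, hv⟩ := chainGraph_adj.1 h
  exact mem_corners.2 ⟨i, hi, hv⟩

theorem chainGraph_adj_east {n : ℕ} {c : ℕ → ℤ × ℤ} {x y : ℤ} :
    (chainGraph n c).Adj (x, y) (x + 1, y) ↔ eastEdge (chainCells n c) x y = true := by
  simp only [chainGraph_adj, eastEdge, Bool.or_eq_true, chainCells_eq_true, ← exists_or,
    ← and_or_left, isSquareCorner_iff, Prod.ext_iff, taxicab]
  constructor
  · rintro ⟨-, i, hi, h⟩
    exact ⟨i, hi, by omega⟩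
  · rintro ⟨i, hi, h⟩
    exact ⟨by omega, i, hi, by omega⟩

theorem chainGraph_adj_north {n : ℕ} {c : ℕ → ℤ × ℤ} {x y : ℤ} :
    (chainGraph n c).Adj (x, y) (x, y + 1) ↔ northEdge (chainCells n c) x y = true := by
  simp only [chainGraph_adj, northEdge, Bool.or_eq_true, chainCells_eq_true, ← exists_or,
    ← and_or_left, isSquareCorner_iff, Prod.ext_iff, taxicab]
  constructor
  · rintro ⟨-, i, hi, h⟩
    exact ⟨i, hi, by omega⟩
  · rintro ⟨i, hi, h⟩
    exact ⟨by omega, i, hi, by omega⟩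

theorem chainGraph_adj_west {n : ℕ} {c : ℕ → ℤ × ℤ} {x y : ℤ} :
    (chainGraph n c).Adj (x, y) (x - 1, y) ↔ eastEdge (chainCells n c) (x - 1) y = true := by
  rw [SimpleGraph.adj_comm, ← chainGraph_adj_east, sub_add_cancel]

theorem chainGraph_adj_south {n : ℕ} {c : ℕ → ℤ × ℤ} {x y : ℤ} :
    (chainGraph n c).Adj (x, y) (x, y - 1) ↔ northEdge (chainCells n c) x (y - 1) = true := by
  rw [SimpleGraph.adj_comm, ← chainGraph_adj_north, sub_add_cancel]

theorem chainGraph_adj_cases {n : ℕ} {c : ℕ → ℤ × ℤ} {x y : ℤ} {v : ℤ × ℤ} :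
    (chainGraph n c).Adj (x, y) v ↔
      v = (x + 1, y) ∧ eastEdge (chainCells n c) x y = true ∨
      v = (x - 1, y) ∧ eastEdge (chainCells n c) (x - 1) y = true ∨
      v = (x, y + 1) ∧ northEdge (chainCells n c) x y = true ∨
      v = (x, y - 1) ∧ northEdge (chainCells n c) x (y - 1) = true := by
  constructor
  · intro h
    have h1 := (chainGraph_adj.1 h).1
    obtain ⟨a, b⟩ := v
    have h2 : (a = x + 1 ∧ b = y) ∨ (a = x - 1 ∧ b = y) ∨ (a = x ∧ b = y + 1) ∨
        (a = x ∧ b = y - 1) := by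
      simp only [taxicab] at h1
      omega
    rcases h2 with ⟨rfl, rfl⟩ | ⟨rfl, rfl⟩ | ⟨rfl, rfl⟩ | ⟨rfl, rfl⟩
    · exact Or.inl ⟨rfl, chainGraph_adj_east.1 h⟩
    · exact Or.inr (Or.inl ⟨rfl, chainGraph_adj_west.1 h⟩)
    · exact Or.inr (Or.inr (Or.inl ⟨rfl, chainGraph_adj_north.1 h⟩))
    · exact Or.inr (Or.inr (Or.inr ⟨rfl, chainGraph_adj_south.1 h⟩))
  · rintro (⟨rfl, h⟩ | ⟨rfl, h⟩ | ⟨rfl, h⟩ | ⟨rfl, h⟩)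
    · exact chainGraph_adj_east.2 h
    · exact chainGraph_adj_west.2 h
    · exact chainGraph_adj_north.2 h
    · exact chainGraph_adj_south.2 h

theorem chainGraph_dist_eq_two {n : ℕ} {c : ℕ → ℤ × ℤ} {u v : ℤ × ℤ} :
    (chainGraph n c).dist u v = 2 ↔
      taxicab u v = 2 ∧ ∃ w, (chainGraph n c).Adj u w ∧ (chainGraph n c).Adj w v := by
  constructor
  · intro h
    have hr : (chainGraph n c).Reachable u v := by
      by_contra hr
      simp [SimpleGraph.dist_eq_zero_of_not_reachable hr] at h
    obtain ⟨p, hp⟩ := hr.exists_walk_length_eq_dist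
    rw [h] at hp
    have hne : u ≠ v := by
      rintro rfl
      simp at h
    rcases p with _ | ⟨h1, _ | ⟨h2, _ | ⟨h3, r⟩⟩⟩
    · simp at hp
    · simp at hp
    · refine ⟨?_, _, h1, h2⟩
      have t1 := (chainGraph_adj.1 h1).1
      have t2 := (chainGraph_adj.1 h2).1
      rw [Ne, Prod.ext_iff] at hne
      simp only [taxicab] at t1 t2 ⊢
      omega
    · simp only [SimpleGraph.Walk.length_cons] at hp
      omega
  · rintro ⟨ht, w, h1, h2⟩
    have hle := SimpleGraph.dist_le (SimpleGraph.Walk.cons h1 (.cons h2 .nil))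
    have h0 : (chainGraph n c).dist u v ≠ 0 := by
      rw [Ne, SimpleGraph.dist_eq_zero_iff_eq_or_not_reachable]
      rintro (rfl | h)
      · simp [taxicab] at ht
      · exact h (h1.reachable.trans h2.reachable)
    have hh1 : (chainGraph n c).dist u v ≠ 1 := by
      rw [Ne, SimpleGraph.dist_eq_one_iff_adj, chainGraph_adj]
      rintro ⟨h, -⟩
      omega
    simp only [SimpleGraph.Walk.length_cons, SimpleGraph.Walk.length_nil] at hle
    omega

theorem tau_eq (n : ℕ) (c : ℕ → ℤ × ℤ) (x y : ℤ) :
    tau n c (x, y) = cellTau (chainCells n c) x y := by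
  set G := chainGraph n c
  set N : Finset (ℤ × ℤ) := {(x + 2, y), (x - 2, y), (x, y + 2), (x, y - 2), (x + 1, y + 1),
    (x - 1, y + 1), (x + 1, y - 1), (x - 1, y - 1)} with hN
  have hfilter : (corners n c).filter (fun u => G.dist (x, y) u = 2) =
      N.filter fun u => ∃ w, G.Adj (x, y) w ∧ G.Adj w u := by
    ext ⟨a, b⟩
    simp only [Finset.mem_filter, G, chainGraph_dist_eq_two]
    have hmem : taxicab (x, y) (a, b) = 2 ↔ (a, b) ∈ N := by
      simp only [hN, Finset.mem_insert, Finset.mem_singleton, Prod.mk.injEq, taxicab]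
      omega
    rw [hmem]
    constructor
    · rintro ⟨-, h⟩
      exact h
    · rintro ⟨h, w, h1, h2⟩
      exact ⟨chainGraph_adj_mem h2, h, w, h1, h2⟩
  have hpath : ∀ u, (∃ w, G.Adj (x, y) w ∧ G.Adj w u) ↔
      eastEdge (chainCells n c) x y = true ∧ G.Adj (x + 1, y) u ∨
      eastEdge (chainCells n c) (x - 1) y = true ∧ G.Adj (x - 1, y) u ∨
      northEdge (chainCells n c) x y = true ∧ G.Adj (x, y + 1) u ∨
      northEdge (chainCells n c) x (y - 1) = true ∧ G.Adj (x, y - 1) u := by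
    intro u
    simp only [G, chainGraph_adj_cases (x := x) (y := y), or_and_right, exists_or, and_assoc,
      exists_eq_left]
  have htoNat : ∀ {p : Prop} {b : Bool}, (p ↔ b = true) → (if p then 1 else 0) = b.toNat := by
    intro p b h
    rcases b <;> simp_all
  have e1 : ∀ z : ℤ, z - 1 - 1 = z - 2 := fun z => by ring
  rw [tau, hfilter, Finset.card_filter, hN]
  repeat rw [Finset.sum_insert (by
    simp only [Finset.mem_insert, Finset.mem_singleton, Prod.mk.injEq]; omega)]
  rw [Finset.sum_singleton]
  simp only [cellTau, add_assoc]
  refine congrArg₂ _ (htoNat ?_) <| congrArg₂ _ (htoNat ?_) <| congrArg₂ _ (htoNat ?_) <|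
    congrArg₂ _ (htoNat ?_) <| congrArg₂ _ (htoNat ?_) <| congrArg₂ _ (htoNat ?_) <|
    congrArg₂ _ (htoNat ?_) (htoNat ?_)
  all_goals
    rw [hpath]
    simp only [G, chainGraph_adj_cases, Prod.mk.injEq, e1, Bool.or_eq_true, Bool.and_eq_true]
    clear hfilter hpath hN htoNat
    grind

theorem ZC2_eq (n : ℕ) (c : ℕ → ℤ × ℤ) : ZC2 n c = cellSum (chainCells n c) / 2 := by
  have hsum : ∀ v ∈ corners n c, (∑ u ∈ corners n c,
      if (chainGraph n c).Adj v u then tau n c v * tau n c u else 0) =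
      cellWeight (chainCells n c) v.1 v.2 := by
    rintro ⟨x, y⟩ -
    set N : Finset (ℤ × ℤ) := {(x + 1, y), (x - 1, y), (x, y + 1), (x, y - 1)} with hN
    rw [← Finset.sum_filter]
    have hfilter : (corners n c).filter (fun u => (chainGraph n c).Adj (x, y) u) =
        N.filter fun u => (chainGraph n c).Adj (x, y) u := by
      ext u
      simp only [Finset.mem_filter]
      refine and_congr_left fun h => ⟨fun _ => ?_, fun _ => chainGraph_adj_mem h⟩
      rcases chainGraph_adj_cases.1 h with h | h | h | h <;> simp [hN, h.1]
    rw [hfilter, Finset.sum_filter, hN]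
    repeat rw [Finset.sum_insert (by
      simp only [Finset.mem_insert, Finset.mem_singleton, Prod.mk.injEq]; omega)]
    rw [Finset.sum_singleton]
    simp only [chainGraph_adj_east, chainGraph_adj_west, chainGraph_adj_north,
      chainGraph_adj_south, tau_eq, cellWeight, add_assoc]
  rw [ZC2, Finset.sum_congr rfl hsum, cellSum, finsum_eq_sum_of_support_subset]
  rintro ⟨x, y⟩ hv
  rw [Finset.mem_coe, mem_corners]
  have := exists_cell_of_cellWeight_ne_zero hv
  simp only [chainCells_eq_true, isSquareCorner_iff] at this ⊢
  rcases this with ⟨i, hi, h⟩ | ⟨i, hi, h⟩ | ⟨i, hi, h⟩ | ⟨i, hi, h⟩ <;>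
    exact ⟨i, hi, by simp [h]⟩

theorem IsPolyominoChain.taxicab_succ {n : ℕ} {c : ℕ → ℤ × ℤ} (hc : IsPolyominoChain n c) {k : ℕ}
    (hk : k + 1 < n) : taxicab (c k) (c (k + 1)) = 1 :=
  (hc.2 k (k + 1) (by omega) hk).2 (Or.inr rfl)

theorem link_eq_one_iff {c : ℕ → ℤ × ℤ} {k : ℕ} :
    link c (k + 3) = 1 ↔ c (k + 2) - c (k + 1) = c (k + 1) - c k := by
  simp [link]

theorem link_eq_two_iff {c : ℕ → ℤ × ℤ} {k : ℕ} :
    link c (k + 3) = 2 ↔ c (k + 2) - c (k + 1) ≠ c (k + 1) - c k := by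
  simp [link]

/-- A kink turns by a right angle. -/
theorem IsPolyominoChain.kink {n : ℕ} {c : ℕ → ℤ × ℤ} (hc : IsPolyominoChain n c) {k : ℕ}
    (hk : k + 2 < n) (h : link c (k + 3) = 2) :
    ((c (k + 2)).1 - (c (k + 1)).1 = -((c (k + 1)).2 - (c k).2) ∧
      (c (k + 2)).2 - (c (k + 1)).2 = (c (k + 1)).1 - (c k).1) ∨
    ((c (k + 2)).1 - (c (k + 1)).1 = (c (k + 1)).2 - (c k).2 ∧
      (c (k + 2)).2 - (c (k + 1)).2 = -((c (k + 1)).1 - (c k).1)) := by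
  have h0 := hc.taxicab_succ (k := k) (by omega)
  have h1 : taxicab (c (k + 1)) (c (k + 2)) = 1 := hc.taxicab_succ hk
  have h2 : c k ≠ c (k + 2) := fun h => by
    have := hc.1 k (k + 2) (by omega) hk h
    omega
  rw [link_eq_two_iff] at h
  simp only [taxicab, Ne, Prod.ext_iff, Prod.fst_sub, Prod.snd_sub] at h0 h1 h2 h
  omega

/-- Two successive kinks turn in opposite directions. -/
theorem IsPolyominoChain.kink_kink {n : ℕ} {c : ℕ → ℤ × ℤ} (hc : IsPolyominoChain n c) {k : ℕ}
    (hk : k + 3 < n) (h : link c (k + 3) = 2) (h' : link c (k + 4) = 2) :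
    c (k + 3) - c (k + 2) = c (k + 1) - c k := by
  have h0 := hc.taxicab_succ (k := k) (by omega)
  have h1 := hc.kink (by omega) h
  have h2 := hc.kink (k := k + 1) hk h'
  have h3 : taxicab (c k) (c (k + 3)) ≠ 1 := fun h => by
    have := (hc.2 k (k + 3) (by omega) hk).1 h
    omega
  simp only [taxicab, Prod.ext_iff, Prod.fst_sub, Prod.snd_sub, add_assoc, Nat.reduceAdd]
    at h0 h1 h2 h3 ⊢
  omega

theorem straight_run {c : ℕ → ℤ × ℤ} {m N : ℕ} {x y a b : ℤ}
    (h : ∀ k, m ≤ k → k + 2 ≤ N → link c (k + 3) = 1) (h0 : c m = (x, y))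
    (h1 : c (m + 1) = (x + a, y + b)) (i : ℕ) (hi : m + i ≤ N) :
    c (m + i) = (x + i * a, y + i * b) := by
  induction i using Nat.strong_induction_on with
  | _ i ih =>
    rcases i with _ | _ | i
    · simpa using h0
    · simpa using h1
    · have e0 := ih i (by omega) (by omega)
      have e1 := ih (i + 1) (by omega) (by omega)
      have e2 := link_eq_one_iff.1 (h (m + i) (by omega) (by omega))
      simp only [← add_assoc, Nat.cast_add, Nat.cast_one] at e1
      change c (m + i + 2) = _
      rw [eq_add_of_sub_eq e2, e1, e0]
      ext <;> simp <;> ring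

theorem IsPolyominoChain.zigzag_run {n : ℕ} {c : ℕ → ℤ × ℤ} (hc : IsPolyominoChain n c) {m N : ℕ}
    {x y a b a' b' : ℤ} (hN : N < n) (h : ∀ k, m ≤ k → k + 2 ≤ N → link c (k + 3) = 2)
    (h0 : c m = (x, y)) (h1 : c (m + 1) = (x + a, y + b))
    (h2 : c (m + 2) = (x + a + a', y + b + b')) (i : ℕ) (hi : m + i ≤ N) :
    c (m + i) = (x + ((i + 1) / 2 : ℕ) * a + (i / 2 : ℕ) * a',
      y + ((i + 1) / 2 : ℕ) * b + (i / 2 : ℕ) * b') := by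
  induction i using Nat.strong_induction_on with
  | _ i ih =>
    rcases i with _ | _ | _ | i
    · simpa using h0
    · simpa using h1
    · simpa using h2
    · have e0 := ih i (by omega) (by omega)
      have e1 := ih (i + 1) (by omega) (by omega)
      have e2 := ih (i + 2) (by omega) (by omega)
      have e3 := hc.kink_kink (k := m + i) (by omega) (h (m + i) (by omega) (by omega))
        (h (m + i + 1) (by omega) (by omega))
      have d1 : (i + 2 + 1) / 2 = (i + 1) / 2 + 1 := by omega
      have d2 : (i + 2) / 2 = i / 2 + 1 := by omega
      have d3 : (i + 3 + 1) / 2 = i / 2 + 2 := by omega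
      have d4 : (i + 3) / 2 = (i + 1) / 2 + 1 := by omega
      have d5 : (i + 1 + 1) / 2 = i / 2 + 1 := by omega
      simp only [← add_assoc] at e1 e2
      change c (m + i + 3) = _
      rw [eq_add_of_sub_eq e3, e2, e1, e0]
      simp only [add_assoc, Nat.reduceAdd] at d1 d3 d5
      ext <;> simp [add_assoc, d1, d2, d3] <;> ring

/-- The chain traversed backwards. -/
def chainReverse (n : ℕ) (c : ℕ → ℤ × ℤ) (i : ℕ) : ℤ × ℤ := c (n - 1 - i)

theorem IsPolyominoChain.reverse {n : ℕ} {c : ℕ → ℤ × ℤ} (hc : IsPolyominoChain n c) :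
    IsPolyominoChain n (chainReverse n c) := by
  refine ⟨fun i j hi hj h => ?_, fun i j hi hj => ?_⟩
  · have := hc.1 _ _ (by omega) (by omega) h
    omega
  · rw [chainReverse, chainReverse, hc.2 _ _ (by omega) (by omega)]
    omega

theorem link_chainReverse {n : ℕ} (c : ℕ → ℤ × ℤ) {k : ℕ} (hk : 3 ≤ k) (hkn : k ≤ n) :
    link (chainReverse n c) k = link c (n + 3 - k) := by
  obtain ⟨j, rfl⟩ := Nat.exists_eq_add_of_le' hk
  obtain ⟨m, rfl⟩ := Nat.exists_eq_add_of_le' hkn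
  have e0 : m + (j + 3) + 3 - (j + 3) = m + 3 := by omega
  have e1 : m + (j + 3) - 1 - (j + 2) = m := by omega
  have e2 : m + (j + 3) - 1 - (j + 1) = m + 1 := by omega
  have e3 : m + (j + 3) - 1 - j = m + 2 := by omega
  simp only [link, chainReverse, e0, Nat.reduceSubDiff, e1, e2, e3, Nat.add_one_sub_one,
    Prod.ext_iff, Prod.fst_sub, Prod.snd_sub]
  refine if_congr ?_ rfl rfl
  omega

theorem chainCells_chainReverse (n : ℕ) (c : ℕ → ℤ × ℤ) :
    chainCells n (chainReverse n c) = chainCells n c := by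
  ext x y
  rw [Bool.eq_iff_iff, chainCells_eq_true, chainCells_eq_true]
  constructor
  · rintro ⟨i, hi, h⟩
    exact ⟨n - 1 - i, by omega, h⟩
  · rintro ⟨i, hi, h⟩
    exact ⟨n - 1 - i, by omega, by rwa [chainReverse, Nat.sub_sub_self (by omega)]⟩

/-- Every chain with a kink is congruent to one which starts at the origin and turns from east to
north at that kink. -/
theorem IsPolyominoChain.exists_normal {n : ℕ} {c : ℕ → ℤ × ℤ} (hc : IsPolyominoChain n c) {j : ℕ}
    (hj : j + 2 < n) (h : link c (j + 3) = 2) : ∃ c' : ℕ → ℤ × ℤ, IsPolyominoChain n c' ∧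
      (∀ k, link c' k = link c k) ∧ cellSum (chainCells n c') = cellSum (chainCells n c) ∧
      c' 0 = (0, 0) ∧ c' (j + 1) - c' j = (1, 0) ∧ c' (j + 2) - c' (j + 1) = (0, 1) := by
  have h0 := hc.taxicab_succ (k := j) (by omega)
  have h1 := hc.kink hj h
  set p := (c 0).1 with hp
  set q := (c 0).2 with hq
  obtain ⟨a, ha⟩ : ∃ a, a = (c (j + 1)).1 - (c j).1 := ⟨_, rfl⟩
  obtain ⟨b, hb⟩ : ∃ b, b = (c (j + 1)).2 - (c j).2 := ⟨_, rfl⟩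
  obtain ⟨a', ha'⟩ : ∃ a, a = (c (j + 2)).1 - (c (j + 1)).1 := ⟨_, rfl⟩
  obtain ⟨b', hb'⟩ : ∃ b, b = (c (j + 2)).2 - (c (j + 1)).2 := ⟨_, rfl⟩
  rw [← ha, ← hb, ← ha', ← hb'] at h1
  have hd : a.natAbs + b.natAbs = 1 := by
    simp only [taxicab] at h0
    omega
  have hab : (a = 1 ∧ b = 0) ∨ (a = -1 ∧ b = 0) ∨ (a = 0 ∧ b = 1) ∨ (a = 0 ∧ b = -1) := by omega
  refine ⟨fun i => (((c i).1 - p) * a + ((c i).2 - q) * b,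
    ((c i).1 - p) * a' + ((c i).2 - q) * b'), ⟨fun i i' hi hi' hii => hc.1 i i' hi hi' ?_,
    fun i i' hi hi' => ?_⟩, fun k => ?_, ?_, ?_, ?_, ?_⟩
  · simp only [Prod.ext_iff] at hii ⊢
    rcases hab with ⟨rfl, rfl⟩ | ⟨rfl, rfl⟩ | ⟨rfl, rfl⟩ | ⟨rfl, rfl⟩ <;>
    rcases h1 with ⟨rfl, rfl⟩ | ⟨rfl, rfl⟩ <;> omega
  · rw [← hc.2 i i' hi hi']
    simp only [taxicab]
    rcases hab with ⟨rfl, rfl⟩ | ⟨rfl, rfl⟩ | ⟨rfl, rfl⟩ | ⟨rfl, rfl⟩ <;>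
    rcases h1 with ⟨rfl, rfl⟩ | ⟨rfl, rfl⟩ <;> omega
  · simp only [link, Prod.ext_iff, Prod.fst_sub, Prod.snd_sub]
    refine if_congr ?_ rfl rfl
    rcases hab with ⟨rfl, rfl⟩ | ⟨rfl, rfl⟩ | ⟨rfl, rfl⟩ | ⟨rfl, rfl⟩ <;>
    rcases h1 with ⟨rfl, rfl⟩ | ⟨rfl, rfl⟩ <;> omega
  · rw [← cellSum_frame (chainCells n c) p q a b a' b' hd h1]
    congr 1
    ext x y
    rw [Bool.eq_iff_iff, chainCells_eq_true, chainCells_eq_true]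
    simp only [Prod.ext_iff]
    refine exists_congr fun i => and_congr_right fun _ => ?_
    rcases hab with ⟨rfl, rfl⟩ | ⟨rfl, rfl⟩ | ⟨rfl, rfl⟩ | ⟨rfl, rfl⟩ <;>
    rcases h1 with ⟨rfl, rfl⟩ | ⟨rfl, rfl⟩ <;> omega
  · simp [hp, hq]
  · simp only [Prod.ext_iff, Prod.fst_sub, Prod.snd_sub]
    rcases hab with ⟨rfl, rfl⟩ | ⟨rfl, rfl⟩ | ⟨rfl, rfl⟩ | ⟨rfl, rfl⟩ <;>
    rcases h1 with ⟨rfl, rfl⟩ | ⟨rfl, rfl⟩ <;> omega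
  · simp only [Prod.ext_iff, Prod.fst_sub, Prod.snd_sub]
    rcases hab with ⟨rfl, rfl⟩ | ⟨rfl, rfl⟩ | ⟨rfl, rfl⟩ | ⟨rfl, rfl⟩ <;>
    rcases h1 with ⟨rfl, rfl⟩ | ⟨rfl, rfl⟩ <;> omega

theorem HasLinks.chainReverse {n : ℕ} {c : ℕ → ℤ × ℤ} {L : ℕ → ℕ} (h : HasLinks n c L) :
    HasLinks n (chainReverse n c) fun k => L (n + 3 - k) := fun k hk hkn => by
  rw [link_chainReverse c hk hkn, h _ (by omega) (by omega)]

theorem chainCells_eq_of_forall {n : ℕ} {c : ℕ → ℤ × ℤ} {S : ℤ → ℤ → Bool}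
    (h : ∀ x y, (∃ i < n, c i = (x, y)) ↔ S x y = true) : chainCells n c = S := by
  ext x y
  rw [Bool.eq_iff_iff, chainCells_eq_true, h]

theorem cellSum_chainCells_eq_hookCells {n : ℕ} (hn : 8 ≤ n) {c : ℕ → ℤ × ℤ}
    (hc : IsPolyominoChain n c) (hL : HasLinks n c fun k => if k = 6 then 2 else 1) :
    cellSum (chainCells n c) = cellSum (hookCells n) := by
  obtain ⟨c', -, hl, hS, h0, h4, h5⟩ := hc.exists_normal (j := 3) (by omega)
    (by simp [hL 6 (by omega) (by omega)])
  have hL' : ∀ k, k + 3 ≤ n → k ≠ 3 → link c' (k + 3) = 1 := fun k hk hk3 => by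
    simp [hl, hL (k + 3) (by omega) hk, hk3]
  have e2 := link_eq_one_iff.1 (hL' 0 (by omega) (by omega))
  have e3 := link_eq_one_iff.1 (hL' 1 (by omega) (by omega))
  have e4 := link_eq_one_iff.1 (hL' 2 (by omega) (by omega))
  simp only [Prod.ext_iff, Prod.fst_sub, Prod.snd_sub, zero_add, Nat.reduceAdd] at h0 h4 h5 e2 e3 e4
  have hrow := straight_run (c := c') (m := 0) (N := 4) (x := 0) (y := 0) (a := 1) (b := 0)
    (fun k _ hk => hL' k (by omega) (by omega)) (Prod.ext_iff.2 (by omega))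
    (Prod.ext_iff.2 (by simp only [Nat.reduceAdd]; omega))
  have hcol := straight_run (c := c') (m := 4) (N := n - 1) (x := 4) (y := 0) (a := 0) (b := 1)
    (fun k _ hk => hL' k (by omega) (by omega)) (Prod.ext_iff.2 (by omega))
    (Prod.ext_iff.2 (by simp only [Nat.reduceAdd]; omega))
  rw [← hS]
  congr 1
  refine chainCells_eq_of_forall fun x y => ?_
  simp only [hookCells, decide_eq_true_eq]
  simp only [Prod.ext_iff, zero_add] at hrow hcol ⊢
  constructor
  · rintro ⟨i, hi, h⟩
    rcases Nat.le_total i 4 with h4 | h4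
    · have := hrow i h4
      omega
    · have := hcol (i - 4) (by omega)
      rw [Nat.add_sub_cancel' h4] at this
      omega
  · rintro (⟨rfl, hx, hx4⟩ | ⟨rfl, hy, hyn⟩)
    · have := hrow x.toNat (by omega)
      exact ⟨x.toNat, by omega, by omega⟩
    · have := hcol y.toNat (by omega)
      exact ⟨4 + y.toNat, by omega, by omega⟩

theorem exists_cellSum_chainCells_eq_doublyCappedLine {n : ℕ} (hn : 8 ≤ n) {c : ℕ → ℤ × ℤ}
    (hc : IsPolyominoChain n c) (hL : HasLinks n c fun k => if k = 3 ∨ k = n then 2 else 1) :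
    ∃ s : ℤ, (s = 1 ∨ s = -1) ∧ cellSum (chainCells n c) = cellSum (doublyCappedLine s n) := by
  obtain ⟨c', hc', hl, hS, h0, h1, h2⟩ := hc.exists_normal (j := 0) (by omega)
    (by simp [hL 3 (by omega) (by omega)])
  simp only [Prod.ext_iff, Prod.fst_sub, Prod.snd_sub, zero_add] at h0 h1 h2
  have hcol := straight_run (c := c') (m := 1) (N := n - 2) (x := 1) (y := 0) (a := 0) (b := 1)
    (fun k _ hk => by
      rw [hl, hL (k + 3) (by omega) (by omega)]
      exact if_neg (by omega))
    (Prod.ext_iff.2 (by omega)) (Prod.ext_iff.2 (by simp only [Nat.reduceAdd]; omega))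
  obtain ⟨m, rfl⟩ := Nat.exists_eq_add_of_le' hn
  have hlast := hc'.kink (k := m + 5) (by omega) (by simp [hl, hL (m + 8) (by omega) (by omega)])
  simp only [Prod.ext_iff] at hcol
  simp only [add_assoc, Nat.reduceAdd] at hlast
  have hm := hcol (m + 4) (by omega)
  have hm' := hcol (m + 5) (by omega)
  rw [show 1 + (m + 4) = m + 5 by omega] at hm
  rw [show 1 + (m + 5) = m + 6 by omega] at hm'
  refine ⟨(c' (m + 7)).1 - 1, by omega, ?_⟩
  rw [← hS]
  congr 1
  refine chainCells_eq_of_forall fun x y => ?_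
  simp only [doublyCappedLine, decide_eq_true_eq, Prod.ext_iff]
  constructor
  · rintro ⟨i, hi, h⟩
    obtain rfl | rfl | ⟨h1, h2⟩ : i = 0 ∨ i = m + 7 ∨ (1 ≤ i ∧ i ≤ m + 6) := by omega
    · omega
    · omega
    · have := hcol (i - 1) (by omega)
      rw [Nat.add_sub_cancel' h1] at this
      omega
  · rintro (⟨rfl, rfl⟩ | ⟨rfl, hy, hyn⟩ | ⟨hx, hy⟩)
    · exact ⟨0, by omega, h0⟩
    · have := hcol y.toNat (by omega)
      exact ⟨1 + y.toNat, by omega, by omega⟩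
    · exact ⟨m + 7, by omega, by omega⟩

theorem exists_cellSum_chainCells_eq_bentZigzag {n : ℕ} (hn : 8 ≤ n) {c : ℕ → ℤ × ℤ}
    (hc : IsPolyominoChain n c) (hL : HasLinks n c fun k => if k = 6 then 1 else 2) :
    ∃ s : ℤ, (s = 1 ∨ s = -1) ∧ cellSum (chainCells n c) = cellSum (bentZigzag s n) := by
  obtain ⟨c', hc', hl, hS, h0, h1, h2⟩ := hc.exists_normal (j := 0) (by omega)
    (by simp [hL 3 (by omega) (by omega)])
  have hL' : ∀ k, k + 3 ≤ n → k ≠ 3 → link c' (k + 3) = 2 := fun k hk hk3 => by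
    simp [hl, hL (k + 3) (by omega) hk, hk3]
  have e5 := link_eq_one_iff.1 (show link c' 6 = 1 by simp [hl, hL 6 (by omega) (by omega)])
  have e6 := hc'.kink (k := 4) (by omega) (hL' 4 (by omega) (by omega))
  simp only [Prod.ext_iff, Prod.fst_sub, Prod.snd_sub, zero_add, Nat.reduceAdd] at h0 h1 h2 e5 e6
  have hzig := hc'.zigzag_run (m := 0) (N := 4) (x := 0) (y := 0) (a := 1) (b := 0) (a' := 0)
    (b' := 1) (by omega) (fun k _ hk => hL' k (by omega) (by omega)) (Prod.ext_iff.2 (by omega))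
    (Prod.ext_iff.2 (by simp only [Nat.reduceAdd]; omega))
    (Prod.ext_iff.2 (by simp only [Nat.reduceAdd]; omega))
  simp only [Prod.ext_iff, zero_add] at hzig
  have c3 := hzig 3 (by omega)
  have c4 := hzig 4 (by omega)
  norm_num at c3 c4
  obtain ⟨s, hs⟩ : ∃ s, s = (c' 6).1 - 2 := ⟨_, rfl⟩
  have hzag := hc'.zigzag_run (m := 4) (N := n - 1) (x := 2) (y := 2) (a := 0) (b := 1) (a' := s)
    (b' := 0) (by omega) (fun k _ hk => hL' k (by omega) (by omega)) (Prod.ext_iff.2 (by omega))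
    (Prod.ext_iff.2 (by simp only [Nat.reduceAdd]; omega))
    (Prod.ext_iff.2 (by simp only [Nat.reduceAdd]; omega))
  have hs1 : s = 1 ∨ s = -1 := by omega
  refine ⟨s, hs1, ?_⟩
  rw [← hS]
  congr 1
  refine chainCells_eq_of_forall fun x y => ?_
  simp only [bentZigzag, decide_eq_true_eq]
  simp only [Prod.ext_iff] at hzag ⊢
  clear hL hl hS h0 h1 h2 e5 e6 c3 c4 hs
  constructor
  · rintro ⟨i, hi, h⟩
    rcases Nat.le_total i 4 with h4 | h4
    · have := hzig i h4
      omega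
    · have := hzag (i - 4) (by omega)
      rw [Nat.add_sub_cancel' h4] at this
      rcases hs1 with rfl | rfl <;> omega
  · rintro (⟨hxy, hx, hy⟩ | ⟨hxy, hn, hy⟩)
    · have := hzig (x + y).toNat (by omega)
      exact ⟨(x + y).toNat, by omega, by omega⟩
    · have := hzag (2 + s * (x - 2) + y - 4).toNat (by omega)
      refine ⟨4 + (2 + s * (x - 2) + y - 4).toNat, by omega, ?_⟩
      rcases hs1 with rfl | rfl <;> omega

theorem cellSum_chainCells_eq_doublyCappedZigzag {n : ℕ} (hn : 8 ≤ n) {c : ℕ → ℤ × ℤ}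
    (hc : IsPolyominoChain n c) (hL : HasLinks n c fun k => if k = 3 ∨ k = n then 1 else 2) :
    cellSum (chainCells n c) = cellSum (doublyCappedZigzag n) := by
  obtain ⟨m, rfl⟩ := Nat.exists_eq_add_of_le' hn
  obtain ⟨c', hc', hl, hS, h0, h1, h2⟩ := hc.exists_normal (j := 1) (by omega)
    (by simp [hL 4 (by omega) (by omega)])
  have e1 := link_eq_one_iff.1 (show link c' 3 = 1 by simp [hl, hL 3 (by omega) (by omega)])
  have hlast := link_eq_one_iff.1
    (show link c' (m + 5 + 3) = 1 by simp [hl, hL (m + 8) (by omega) (by omega)])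
  simp only [Prod.ext_iff, Prod.fst_sub, Prod.snd_sub, zero_add, Nat.reduceAdd, add_assoc]
    at h0 h1 h2 e1 hlast
  have hzig := hc'.zigzag_run (m := 1) (N := m + 6) (x := 1) (y := 0) (a := 1) (b := 0) (a' := 0)
    (b' := 1) (by omega) (fun k _ hk => by
      rw [hl, hL (k + 3) (by omega) (by omega)]
      exact if_neg (by omega))
    (Prod.ext_iff.2 (by omega)) (Prod.ext_iff.2 (by simp only [Nat.reduceAdd]; omega))
    (Prod.ext_iff.2 (by simp only [Nat.reduceAdd]; omega))
  simp only [Prod.ext_iff] at hzig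
  have hm := hzig (m + 4) (by omega)
  have hm' := hzig (m + 5) (by omega)
  rw [show 1 + (m + 4) = m + 5 by omega] at hm
  rw [show 1 + (m + 5) = m + 6 by omega] at hm'
  rw [← hS]
  congr 1
  refine chainCells_eq_of_forall fun x y => ?_
  simp only [doublyCappedZigzag, decide_eq_true_eq, Prod.ext_iff]
  clear hL hl hS h1 h2 e1
  constructor
  · rintro ⟨i, hi, h⟩
    obtain rfl | rfl | ⟨h1, h2⟩ : i = 0 ∨ i = m + 7 ∨ (1 ≤ i ∧ i ≤ m + 6) := by omega
    · omega
    · omega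
    · have := hzig (i - 1) (by omega)
      rw [Nat.add_sub_cancel' h1] at this
      omega
  · rintro (⟨rfl, rfl⟩ | ⟨hx, hy, hyn⟩ | ⟨hx, hy⟩)
    · exact ⟨0, by omega, h0⟩
    · have := hzig (x + y - 1).toNat (by omega)
      exact ⟨1 + (x + y - 1).toNat, by omega, by omega⟩
    · exact ⟨m + 7, by omega, by omega⟩

/-- **Proposition 2.10 (final inequalities).** For `n ≥ 8`:
`ZC2(PC(1^{n-6},2,1,1,1)) < ZC2(PC(2,1^{n-4},2))` and
`ZC2(PC(2^{n-6},1,2,2,2)) > ZC2(PC(1,2^{n-4},1))`. -/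
theorem ZC2_two_kink_comparisons
    (n : ℕ) (hn : 8 ≤ n)
    (c1 c2 c3 c4 : ℕ → ℤ × ℤ)
    (hc1 : IsPolyominoChain n c1) (hc2 : IsPolyominoChain n c2)
    (hc3 : IsPolyominoChain n c3) (hc4 : IsPolyominoChain n c4)
    (hL1 : HasLinks n c1 fun k => if k = n - 3 then 2 else 1)
    (hL2 : HasLinks n c2 fun k => if k = 3 ∨ k = n then 2 else 1)
    (hL3 : HasLinks n c3 fun k => if k = n - 3 then 1 else 2)
    (hL4 : HasLinks n c4 fun k => if k = 3 ∨ k = n then 1 else 2) :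
    ZC2 n c1 < ZC2 n c2 ∧ ZC2 n c4 < ZC2 n c3 := by
  have hL1' : HasLinks n (chainReverse n c1) fun k => if k = 6 then 2 else 1 := fun k hk hkn => by
    rw [hL1.chainReverse k hk hkn]
    exact if_congr (by omega) rfl rfl
  have hL3' : HasLinks n (chainReverse n c3) fun k => if k = 6 then 1 else 2 := fun k hk hkn => by
    rw [hL3.chainReverse k hk hkn]
    exact if_congr (by omega) rfl rfl
  have h1 := cellSum_chainCells_eq_hookCells hn hc1.reverse hL1'
  obtain ⟨s, hs, h2⟩ := exists_cellSum_chainCells_eq_doublyCappedLine hn hc2 hL2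
  obtain ⟨t, ht, h3⟩ := exists_cellSum_chainCells_eq_bentZigzag hn hc3.reverse hL3'
  have h4 := cellSum_chainCells_eq_doublyCappedZigzag hn hc4 hL4
  rw [chainCells_chainReverse] at h1 h3
  rw [ZC2_eq, ZC2_eq, ZC2_eq, ZC2_eq, h1, h2, h3, h4]
  have := cellSum_hookCells_le hn
  have := cellSum_doublyCappedLine hn hs
  have := le_cellSum_bentZigzag hn ht
  have := cellSum_doublyCappedZigzag hn
  omega
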